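/- Let q be an odd prime power, let SU(4, q) be the subgroup of SL(4, F_{q²}) consisting of all matrices g with σ(g)ᵀ g = 1, where σ is the q-th power Frobenius applied entrywise, and let r be a prime dividing q² − q + 1 but not dividing q + 1. Then there exists g ∈ SU(4, q) of order r such that ⟨g⟩ ∩ Z(SU(4, q)) = 1. Such a g may be chosen so that its characteristic polynomial, regarded over F_{q⁶}, equals (X − 1)(X − θ)(X − θ^{−q})(X − θ^{q²}) for some θ ∈ F_{q⁶} of multiplicative order r. -/

import Mathlib

open Matrix Polynomial

/-- The 2-part of a natural number: the highest power of `2` dividing it. -/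
def twoPart (n : ℕ) : ℕ := 2 ^ padicValNat 2 n

/-- The special unitary group `SU(4, q)` inside `SL(4, F_{q²})`:
matrices `g` with `σ(g)ᵀ * g = 1`, where `σ` is the `q`-th power Frobenius. -/
def SU4 (p m : ℕ) [Fact p.Prime] (F : Type*) [Field F] [Fintype F] [CharP F p]
    (hF : Fintype.card F = (p ^ m) ^ 2) :
    Subgroup (SpecialLinearGroup (Fin 4) F) where
  carrier := { g | ((g : Matrix (Fin 4) (Fin 4) F).map (iterateFrobenius F p m))ᵀ * g = 1 }
  one_mem' := by
    simp [Matrix.map_one]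
  mul_mem' := by
    intro a b ha hb
    simp only [Set.mem_setOf_eq] at *
    have : ((a * b : SpecialLinearGroup (Fin 4) F) : Matrix (Fin 4) (Fin 4) F)
        = (a : Matrix (Fin 4) (Fin 4) F) * b := rfl
    rw [this, Matrix.map_mul, transpose_mul, mul_assoc,
      ← mul_assoc ((a : Matrix (Fin 4) (Fin 4) F).map _)ᵀ, ha, one_mul, hb]
  inv_mem' := by
    intro a ha
    simp only [Set.mem_setOf_eq] at *
    set σ := iterateFrobenius F p m with hσ
    set A := (a : Matrix (Fin 4) (Fin 4) F) with hA
    have hdet : det ((A.map σ)ᵀ) = 1 := by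
      rw [det_transpose, ← RingHom.mapMatrix_apply, ← RingHom.map_det, hA, a.det_coe,
        _root_.map_one]
    let M : SpecialLinearGroup (Fin 4) F := ⟨(A.map σ)ᵀ, hdet⟩
    have h1 : M * a = 1 := Subtype.ext ha
    have h2 : ((a⁻¹ : SpecialLinearGroup (Fin 4) F) : Matrix (Fin 4) (Fin 4) F)
        = (A.map σ)ᵀ := by
      rw [← eq_inv_of_mul_eq_one_left h1]
    rw [h2]
    have hσσ : ∀ x : F, σ (σ x) = x := by
      intro x
      rw [hσ, iterateFrobenius_def, iterateFrobenius_def, ← pow_mul, ← pow_two,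
        ← hF, FiniteField.pow_card]
    have h3 : ((A.map σ)ᵀ.map σ)ᵀ = A := by
      rw [← Matrix.transpose_map, transpose_transpose, Matrix.map_map]
      have : (⇑σ ∘ ⇑σ) = id := funext fun x => hσσ x
      rw [this, Matrix.map_id]
    rw [h3]
    exact mul_eq_one_comm.mp ha

section HermitianForms

variable {K V : Type*} [Field K] [AddCommGroup V] [Module K V] {σ : K →+* K}
  {h : V → V →ₗ[K] K}

/-- Away from characteristic two, a Hermitian form that vanishes on the diagonal of a subspace
vanishes on that subspace. -/
theorem hermitian_eq_zero_of_diag_eq_zero (h2 : (2 : K) ≠ 0) (herm : ∀ x y, h y x = σ (h x y))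
    (W : Submodule K V) (hW : ∀ w ∈ W, h w w = 0) {x y : V} (hx : x ∈ W) (hy : y ∈ W) :
    h x y = 0 := by
  by_contra hxy
  set t := h x y with ht
  have hz := hW (x + t⁻¹ • y) (W.add_mem hx (W.smul_mem _ hy))
  have hzx : h (x + t⁻¹ • y) x = 1 := by
    rw [herm x, map_add, map_smul, hW x hx, ← ht, smul_eq_mul, inv_mul_cancel₀ hxy, zero_add,
      map_one]
  have hzy : h (x + t⁻¹ • y) y = t := by
    rw [herm y, map_add, map_smul, hW y hy, smul_zero, add_zero, ← herm]
  rw [map_add, map_smul, hzx, hzy, smul_eq_mul, inv_mul_cancel₀ hxy, one_add_one_eq_two] at hz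
  exact h2 hz

theorem exists_orthonormal_snoc [FiniteDimensional K V] (h2 : (2 : K) ≠ 0)
    (hnorm : ∀ a : K, σ a = a → ∃ c, σ c * c = a)
    (herm : ∀ x y, h y x = σ (h x y)) (hnd : ∀ x, (∀ y, h x y = 0) → x = 0)
    {k : ℕ} (hk : k < Module.finrank K V) (e : Fin k → V)
    (he : ∀ i j, h (e i) (e j) = if i = j then 1 else 0) :
    ∃ e' : Fin (k + 1) → V, ∀ i j, h (e' i) (e' j) = if i = j then 1 else 0 := by
  let W : Submodule K V := ⨅ i, LinearMap.ker (h (e i))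
  have memW : ∀ x, x ∈ W ↔ ∀ i, h (e i) x = 0 := fun x ↦ by simp [W]
  obtain ⟨w, hwW, hw⟩ : ∃ w ∈ W, h w w ≠ 0 := by
    by_contra! hcon
    have hproj : ∀ v, v - ∑ i, h (e i) v • e i ∈ W := fun v ↦ by
      rw [memW]
      intro j
      simp [he]
    have hWbot : ∀ w ∈ W, w = 0 := fun w hw ↦ hnd w fun y ↦ by
      have h0 := hermitian_eq_zero_of_diag_eq_zero h2 herm W hcon hw (hproj y)
      rw [map_sub, sub_eq_zero] at h0
      rw [h0, map_sum]
      refine Finset.sum_eq_zero fun i _ ↦ ?_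
      rw [map_smul, herm (e i) w, (memW w).1 hw i, map_zero, smul_zero]
    have hspan : Submodule.span K (Set.range e) = ⊤ := by
      refine eq_top_iff.2 fun v _ ↦ ?_
      rw [sub_eq_zero.1 (hWbot _ (hproj v))]
      exact Submodule.sum_mem _ fun i _ ↦
        Submodule.smul_mem _ _ (Submodule.subset_span ⟨i, rfl⟩)
    have := finrank_range_le_card (R := K) e
    rw [Set.finrank, hspan, finrank_top, Fintype.card_fin] at this
    omega
  obtain ⟨c, hc⟩ := hnorm (h w w)⁻¹ (by rw [map_inv₀, ← herm])
  have hew : ∀ i, h (e i) (c • w) = 0 := fun i ↦ by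
    rw [map_smul, (memW w).1 hwW i, smul_zero]
  refine ⟨Fin.snoc e (c • w), fun i j ↦ ?_⟩
  induction i using Fin.lastCases with
  | last =>
    induction j using Fin.lastCases with
    | last =>
      simp only [Fin.snoc_last, if_true]
      rw [map_smul, herm w, map_smul, smul_eq_mul, smul_eq_mul, map_mul, ← herm, ← mul_assoc,
        mul_comm c, hc, inv_mul_cancel₀ hw]
    | cast j =>
      simp only [Fin.snoc_last, Fin.snoc_castSucc]
      rw [herm (e j), hew, map_zero, if_neg (Fin.castSucc_lt_last j).ne']
  | cast i =>
    induction j using Fin.lastCases with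
    | last =>
      simp only [Fin.snoc_last, Fin.snoc_castSucc]
      rw [hew, if_neg (Fin.castSucc_lt_last i).ne]
    | cast j => simp [he]

theorem exists_orthonormal_family [FiniteDimensional K V] (h2 : (2 : K) ≠ 0)
    (hnorm : ∀ a : K, σ a = a → ∃ c, σ c * c = a)
    (herm : ∀ x y, h y x = σ (h x y)) (hnd : ∀ x, (∀ y, h x y = 0) → x = 0)
    (k : ℕ) (hk : k ≤ Module.finrank K V) :
    ∃ e : Fin k → V, ∀ i j, h (e i) (e j) = if i = j then 1 else 0 := by
  induction k with
  | zero => exact ⟨Fin.elim0, fun i ↦ i.elim0⟩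
  | succ k ih =>
    obtain ⟨e, he⟩ := ih (by omega)
    exact exists_orthonormal_snoc h2 hnorm herm hnd (by omega) e he

theorem exists_orthonormal_basis [FiniteDimensional K V] (h2 : (2 : K) ≠ 0)
    (hnorm : ∀ a : K, σ a = a → ∃ c, σ c * c = a)
    (herm : ∀ x y, h y x = σ (h x y)) (hnd : ∀ x, (∀ y, h x y = 0) → x = 0)
    {n : ℕ} (hn : Module.finrank K V = n) :
    ∃ b : Module.Basis (Fin n) K V, ∀ i j, h (b i) (b j) = if i = j then 1 else 0 := by
  obtain ⟨e, he⟩ := exists_orthonormal_family h2 hnorm herm hnd n hn.ge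
  have hli : LinearIndependent K e := by
    rw [Fintype.linearIndependent_iff]
    intro g hg i
    have := congrArg (h (e i)) hg
    simpa [he] using this
  refine ⟨basisOfLinearIndependentOfCardEqFinrank' e hli (by simp [hn]), fun i j ↦ ?_⟩
  simpa using he i j

theorem toMatrix_isometry_unitary {n : ℕ} (herm : ∀ x y, h y x = σ (h x y))
    (b : Module.Basis (Fin n) K V) (hb : ∀ i j, h (b i) (b j) = if i = j then 1 else 0)
    (T : V →ₗ[K] V) (hT : ∀ x y, h (T x) (T y) = h x y) :
    ((LinearMap.toMatrix b b T).map σ)ᵀ * LinearMap.toMatrix b b T = 1 := by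
  have hrepr : ∀ x i, h (b i) x = b.repr x i := fun x i ↦ by
    conv_lhs => rw [← b.sum_repr x]
    simp [-Module.Basis.sum_repr, hb]
  ext i j
  rw [mul_apply, one_apply, ← hb, ← hT]
  conv_rhs => rw [← b.sum_repr (T (b j))]
  simp only [map_sum, map_smul, transpose_apply, map_apply, LinearMap.toMatrix_apply, smul_eq_mul]
  refine Finset.sum_congr rfl fun k _ ↦ ?_
  rw [herm (b k) (T (b i)), hrepr, mul_comm]

end HermitianForms

/-- The norm map of a quadratic extension of finite fields is surjective. -/
theorem exists_pow_mul_self_eq {F : Type*} [Field F] [Fintype F] {q : ℕ}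
    (hF : Fintype.card F = q ^ 2) (a : F) (ha : a ^ q = a) : ∃ c : F, c ^ q * c = a := by
  classical
  rcases eq_or_ne a 0 with rfl | ha0
  · exact ⟨0, mul_zero _⟩
  have hq : 2 ≤ q := by
    have := Fintype.one_lt_card (α := F)
    by_contra! hlt
    interval_cases q <;> omega
  obtain ⟨s, rfl⟩ := Nat.exists_eq_add_of_le' hq
  obtain ⟨ζ, hζ⟩ := IsCyclic.exists_generator (α := Fˣ)
  obtain ⟨k, hk : ζ ^ k = Units.mk0 a ha0⟩ := mem_powers_iff_mem_zpowers.2 (hζ (Units.mk0 a ha0))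
  have hord : orderOf ζ = (s + 1) * (s + 3) := by
    rw [orderOf_eq_card_of_forall_mem_zpowers hζ, Nat.card_eq_fintype_card, Fintype.card_units, hF]
    have : (s + 2) ^ 2 = (s + 1) * (s + 3) + 1 := by ring
    omega
  have hk1 : ζ ^ ((s + 1) * k) = 1 := by
    rw [mul_comm, pow_mul, hk]
    ext
    have : a ^ (s + 1) * a = 1 * a := by rw [← pow_succ, ha, one_mul]
    simpa using mul_right_cancel₀ ha0 this
  have hdvd := orderOf_dvd_of_pow_eq_one hk1
  rw [hord] at hdvd
  obtain ⟨l, rfl⟩ := Nat.dvd_of_mul_dvd_mul_left (by omega) hdvd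
  refine ⟨(ζ ^ l : Fˣ), ?_⟩
  have := congrArg Units.val hk
  rw [← pow_succ, ← Units.val_pow_eq_pow_val, ← pow_mul, mul_comm]
  exact this

theorem two_ne_zero_of_odd_card {F : Type*} [Field F] [Fintype F] (h : Odd (Fintype.card F)) :
    (2 : F) ≠ 0 :=
  Ring.two_ne_zero fun h2 ↦ by
    have := FiniteField.even_card_of_char_two h2
    have := Nat.odd_iff.1 h
    omega

/-- The Hermitian form `(a, x), (b, y) ↦ a ^ q * b + Tr (x ^ q ^ 3 * y)` on `F × E`. -/
noncomputable def traceHermitianForm (F E : Type*) [Field F] [Field E] [Algebra F E] (q : ℕ)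
    (x : F × E) : F × E →ₗ[F] F :=
  x.1 ^ q • LinearMap.fst F F E +
    (Algebra.trace F E ∘ₗ LinearMap.mulLeft F (x.2 ^ q ^ 3)) ∘ₗ LinearMap.snd F F E

theorem traceHermitianForm_apply {F E : Type*} [Field F] [Field E] [Algebra F E] (q : ℕ)
    (x y : F × E) :
    traceHermitianForm F E q x y = x.1 ^ q * y.1 + Algebra.trace F E (x.2 ^ q ^ 3 * y.2) := by
  simp [traceHermitianForm]

section FiniteFields

variable {F E : Type*} [Field F] [Fintype F] [Field E] [Fintype E] [Algebra F E] {q : ℕ}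

theorem finrank_eq_three (hF : Fintype.card F = q ^ 2) (hE : Fintype.card E = q ^ 6) :
    Module.finrank F E = 3 := by
  have hlt : 1 < Fintype.card F := Fintype.one_lt_card
  have hcard := Module.card_eq_pow_finrank (K := F) (V := E)
  refine Nat.pow_right_injective hlt (hcard.symm.trans ?_)
  simp only [hE, hF, ← pow_mul]

theorem algebraMap_trace_cubic (hF : Fintype.card F = q ^ 2) (hE : Fintype.card E = q ^ 6) (z : E) :
    algebraMap F E (Algebra.trace F E z) = z + z ^ q ^ 2 + z ^ q ^ 4 := by
  rw [FiniteField.algebraMap_trace_eq_sum_pow, finrank_eq_three hF hE, Nat.card_eq_fintype_card, hF]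
  simp [Finset.sum_range_succ, ← pow_mul]

theorem trace_pow_cube {p m : ℕ} [Fact p.Prime] [CharP F p] [CharP E p] (hq : q = p ^ m)
    (hF : Fintype.card F = q ^ 2) (hE : Fintype.card E = q ^ 6) (z : E) :
    Algebra.trace F E (z ^ q ^ 3) = Algebra.trace F E z ^ q := by
  apply (algebraMap F E).injective
  have hfrob : ∀ x y : E, (x + y) ^ q = x ^ q + y ^ q := fun x y ↦ by
    rw [hq, add_pow_char_pow]
  have hz : z ^ q ^ 6 = z := by rw [← hE, FiniteField.pow_card]
  have hz7 : z ^ q ^ 7 = z ^ q := by rw [pow_succ q 6, pow_mul, hz]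
  rw [map_pow (algebraMap F E), algebraMap_trace_cubic hF hE, algebraMap_trace_cubic hF hE, hfrob, hfrob]
  simp only [← pow_mul, ← pow_add, ← pow_succ]
  norm_num
  rw [hz7]
  ring

theorem traceHermitianForm_hermitian {p m : ℕ} [Fact p.Prime] [CharP F p] [CharP E p]
    (hq : q = p ^ m) (hF : Fintype.card F = q ^ 2) (hE : Fintype.card E = q ^ 6) (x y : F × E) :
    traceHermitianForm F E q y x = iterateFrobenius F p m (traceHermitianForm F E q x y) := by
  have hx1 : (x.1 ^ q) ^ q = x.1 := by rw [← pow_mul, ← pow_two, ← hF, FiniteField.pow_card]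
  have hx2 : (x.2 ^ q ^ 3) ^ q ^ 3 = x.2 := by
    rw [← pow_mul, ← pow_add, ← hE, FiniteField.pow_card]
  simp only [traceHermitianForm_apply, map_add, iterateFrobenius_def, ← hq]
  rw [← trace_pow_cube hq hF hE, mul_pow, mul_pow, hx1, hx2, mul_comm, mul_comm x.2]

theorem traceHermitianForm_nondegenerate (hq : q ≠ 0) (x : F × E)
    (hx : ∀ y, traceHermitianForm F E q x y = 0) : x = 0 := by
  simp only [traceHermitianForm_apply] at hx
  have h1 := hx (1, 0)
  have h2 : x.2 ^ q ^ 3 = 0 := by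
    refine (traceForm_nondegenerate F E).1 _ fun y ↦ ?_
    simpa using hx (0, y)
  ext
  · simpa [hq] using h1
  · exact eq_zero_of_pow_eq_zero h2

theorem exists_basis_leftMulMatrix_unitary {p m : ℕ} [Fact p.Prime] [CharP F p] [CharP E p]
    (hq : q = p ^ m) (hodd : Odd q) (hF : Fintype.card F = q ^ 2) (hE : Fintype.card E = q ^ 6)
    (θ : E) (hθ : θ ^ q ^ 3 * θ = 1) :
    ∃ b : Module.Basis (Fin 4) F (F × E),
      ((Algebra.leftMulMatrix b (1, θ)).map (iterateFrobenius F p m))ᵀ *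
        Algebra.leftMulMatrix b (1, θ) = 1 := by
  have hfr : Module.finrank F (F × E) = 4 := by
    rw [Module.finrank_prod, finrank_eq_three hF hE, Module.finrank_self]
  have hnorm : ∀ a : F, iterateFrobenius F p m a = a → ∃ c, iterateFrobenius F p m c * c = a := by
    simp only [iterateFrobenius_def, ← hq]
    exact exists_pow_mul_self_eq hF
  have herm := traceHermitianForm_hermitian (E := E) hq hF hE
  obtain ⟨b, hb⟩ := exists_orthonormal_basis (two_ne_zero_of_odd_card (hF ▸ hodd.pow)) hnorm herm
    (traceHermitianForm_nondegenerate hodd.pos.ne') hfr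
  refine ⟨b, toMatrix_isometry_unitary herm b hb (Algebra.lmul F (F × E) (1, θ)) fun x y ↦ ?_⟩
  simp only [traceHermitianForm_apply, Algebra.coe_lmul_eq_mul, LinearMap.mul_apply', Prod.fst_mul,
    Prod.snd_mul, one_mul]
  rw [mul_pow, mul_mul_mul_comm, hθ, one_mul]

end FiniteFields

/-- Multiplication by `(1, θ)` on `F × E` has eigenvalue `1` and the Galois conjugates of `θ`. -/
theorem charpoly_leftMulMatrix_one_prod {F E : Type*} [Field F] [Fintype F] [Field E]
    [Algebra F E] {q : ℕ} (hF : Fintype.card F = q ^ 2)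
    (b : Module.Basis (Fin 4) F (F × E)) (θ : E)
    (hnodup : ({1, θ, θ ^ q ^ 4, θ ^ q ^ 2} : Multiset E).Nodup) :
    ((Algebra.leftMulMatrix b (1, θ)).map (algebraMap F E)).charpoly =
      (X - 1) * (X - C θ) * (X - C (θ ^ q ^ 4)) * (X - C (θ ^ q ^ 2)) := by
  set A := Algebra.leftMulMatrix b (1, θ) with hA
  have haeval : aeval ((1, θ) : F × E) A.charpoly = 0 := by
    apply Algebra.leftMulMatrix_injective b
    rw [← aeval_algHom_apply, ← hA, aeval_self_charpoly, map_zero]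
  have h1 : aeval (1 : E) A.charpoly = 0 := by
    have := congrArg (AlgHom.fst F F E) haeval
    rw [← aeval_algHom_apply] at this
    have := congrArg (algebraMap F E) this
    simpa [aeval_algebraMap_apply, aeval_def, eval₂_at_one] using this
  have hθ : aeval θ A.charpoly = 0 := by
    have := congrArg (AlgHom.snd F F E) haeval
    rw [← aeval_algHom_apply] at this
    simpa using this
  have hconj : ∀ x : E, aeval x A.charpoly = 0 → aeval (x ^ q ^ 2) A.charpoly = 0 := by
    intro x hx
    have := aeval_algHom_apply (FiniteField.frobeniusAlgHom F E) x A.charpoly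
    rw [hx, map_zero] at this
    simpa [hF] using this
  have hθ2 := hconj _ hθ
  have hθ4 := hconj _ hθ2
  rw [← pow_mul, ← pow_add] at hθ4
  have hmonic : (A.charpoly.map (algebraMap F E)).Monic := A.charpoly_monic.map _
  rw [charpoly_map]
  have hle : ({1, θ, θ ^ q ^ 4, θ ^ q ^ 2} : Multiset E) ≤
      (A.charpoly.map (algebraMap F E)).roots := by
    rw [Multiset.le_iff_subset hnodup]
    intro x hx
    rw [mem_roots hmonic.ne_zero, IsRoot, eval_map_algebraMap]
    simp only [Multiset.insert_eq_cons, Multiset.mem_cons, Multiset.mem_singleton] at hx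
    rcases hx with rfl | rfl | rfl | rfl <;> assumption
  have hdvd := (Multiset.prod_X_sub_C_dvd_iff_le_roots hmonic.ne_zero _).2 hle
  have := eq_of_monic_of_dvd_of_natDegree_le (monic_multiset_prod_of_monic _ _
    fun x _ ↦ monic_X_sub_C x) hmonic hdvd ?_
  · rw [this]
    simp [mul_assoc]
  · rw [natDegree_multiset_prod_X_sub_C_eq_card, A.charpoly_monic.natDegree_map, charpoly_natDegree_eq_dim]
    simp

section SpecialUnitary

variable {p m : ℕ} [Fact p.Prime] {F : Type*} [Field F] [Fintype F] [CharP F p]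
  {hF : Fintype.card F = (p ^ m) ^ 2}

variable (hF) in
/-- The diagonal matrix of an even sign vector, as an element of `SU(4, q)`. -/
def SU4.signDiagonal (ε : Fin 4 → ℤˣ) (hε : ∏ i, ε i = 1) :
    SU4 p m F hF :=
  ⟨⟨diagonal fun i ↦ ((ε i : ℤ) : F), by
      rw [det_diagonal]
      exact_mod_cast congrArg (fun u : ℤˣ ↦ ((u : ℤ) : F)) hε⟩, by
    change ((diagonal fun i ↦ ((ε i : ℤ) : F)).map _)ᵀ * (diagonal fun i ↦ ((ε i : ℤ) : F)) = 1
    rw [diagonal_map (map_zero _), diagonal_transpose, diagonal_mul_diagonal, ← diagonal_one]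
    congr 1
    funext i
    rw [map_intCast]
    exact_mod_cast congrArg (fun u : ℤˣ ↦ ((u : ℤ) : F)) (Int.units_mul_self (ε i))⟩

theorem exists_even_sign_separating : ∀ i j : Fin 4, i ≠ j →
    ∃ ε : Fin 4 → ℤˣ, ∏ k, ε k = 1 ∧ ε i = 1 ∧ ε j = -1 := by
  decide

theorem SU4.apply_eq_zero_of_mem_center (h2 : (2 : F) ≠ 0) {g : SU4 p m F hF}
    (hg : g ∈ Subgroup.center (SU4 p m F hF)) {i j : Fin 4} (hij : i ≠ j) :
    (g : SpecialLinearGroup (Fin 4) F) i j = 0 := by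
  obtain ⟨ε, hε, hi, hj⟩ := exists_even_sign_separating i j hij
  have hcomm := Subgroup.mem_center_iff.1 hg (SU4.signDiagonal hF ε hε)
  have hmat : (diagonal fun i ↦ ((ε i : ℤ) : F)) * (g : SpecialLinearGroup (Fin 4) F).1 =
      (g : SpecialLinearGroup (Fin 4) F).1 * (diagonal fun i ↦ ((ε i : ℤ) : F)) :=
    congrArg (fun a : SU4 p m F hF ↦ (a : SpecialLinearGroup (Fin 4) F).1) hcomm
  have hentry := congrFun (congrFun hmat i) j
  rw [diagonal_mul, mul_diagonal, hi, hj] at hentry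
  have h0 : (2 : F) * (g : SpecialLinearGroup (Fin 4) F).1 i j = 0 := by
    push_cast at hentry
    linear_combination hentry
  exact (mul_eq_zero.1 h0).resolve_left h2

/-- Eigenvalues of central elements of `SU(4, q)` lie in `F`. -/
theorem SU4.exists_eq_of_mem_center (h2 : (2 : F) ≠ 0) {g : SU4 p m F hF}
    (hg : g ∈ Subgroup.center (SU4 p m F hF)) {E : Type*} [Field E] (f : F →+* E) {x : E}
    (hx : (((g : SpecialLinearGroup (Fin 4) F) :
      Matrix (Fin 4) (Fin 4) F).map f).charpoly.IsRoot x) :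
    ∃ a : F, f a = x := by
  have hdiag : ((g : SpecialLinearGroup (Fin 4) F) : Matrix (Fin 4) (Fin 4) F) =
      diagonal fun i ↦ (g : SpecialLinearGroup (Fin 4) F) i i := by
    ext i j
    rcases eq_or_ne i j with rfl | hij
    · rw [diagonal_apply_eq]
    · rw [diagonal_apply_ne _ hij]
      exact SU4.apply_eq_zero_of_mem_center h2 hg hij
  rw [hdiag, diagonal_map (map_zero f), charpoly_diagonal, IsRoot, eval_prod,
    Finset.prod_eq_zero_iff] at hx
  obtain ⟨i, -, hi⟩ := hx
  rw [eval_sub, eval_X, eval_C, sub_eq_zero] at hi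
  exact ⟨_, hi.symm⟩

end SpecialUnitary

theorem zpowers_inf_eq_bot_of_prime_orderOf {G : Type*} [Group G] {g : G} {r : ℕ} (hr : r.Prime)
    (hg : orderOf g = r) {H : Subgroup G} (hgH : g ∉ H) : Subgroup.zpowers g ⊓ H = ⊥ := by
  have : Fact r.Prime := ⟨hr⟩
  have : Finite (Subgroup.zpowers g) := by
    refine Set.Finite.to_subtype (finite_zpowers.2 (orderOf_pos_iff.1 ?_))
    exact hg ▸ hr.pos
  rw [Subgroup.eq_bot_iff_forall]
  rintro z ⟨hz, hzH⟩
  by_contra hz1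
  have hzr : orderOf z = r :=
    orderOf_eq_prime (orderOf_dvd_iff_pow_eq_one.1 (hg ▸ orderOf_dvd_of_mem_zpowers hz)) hz1
  have heq : Subgroup.zpowers z = Subgroup.zpowers g :=
    Subgroup.eq_of_le_of_card_ge (Subgroup.zpowers_le.2 hz)
      (by rw [Nat.card_zpowers, Nat.card_zpowers, hg, hzr])
  exact hgH (Subgroup.zpowers_le.2 hzH (heq ▸ Subgroup.mem_zpowers g))

section Arithmetic

variable {q r : ℕ}

theorem dvd_cube_add_one (h : r ∣ q ^ 2 - q + 1) : r ∣ q ^ 3 + 1 := by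
  have hle : q ≤ q ^ 2 := Nat.le_self_pow two_ne_zero q
  have : q ^ 3 + 1 = (q ^ 2 - q + 1) * (q + 1) := by
    zify [hle]
    ring
  exact this ▸ h.mul_right _

theorem not_dvd_sq_sub_one (hr : r.Prime) (h : r ∣ q ^ 2 - q + 1) (hn : ¬ r ∣ q + 1) :
    ¬ (r : ℤ) ∣ q ^ 2 - 1 := by
  have hle : q ≤ q ^ 2 := Nat.le_self_pow two_ne_zero q
  intro hd
  have hr' := Nat.prime_iff_prime_int.1 hr
  have h' : (r : ℤ) ∣ q ^ 2 - q + 1 := by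
    have := Int.natCast_dvd_natCast.2 h
    push_cast [hle] at this
    exact this
  have hn' : ¬ (r : ℤ) ∣ q + 1 := fun hd ↦ hn (by exact_mod_cast hd)
  rw [show (q : ℤ) ^ 2 - 1 = (q + 1) * (q - 1) by ring] at hd
  have h1 := (hr'.dvd_or_dvd hd).resolve_left hn'
  refine hr'.not_isUnit (isUnit_of_dvd_one ?_)
  have := dvd_sub h' (h1.mul_left q)
  ring_nf at this
  exact this

end Arithmetic

/-- For `q` an odd prime power and `r` a prime dividing `q² - q + 1` but not `q + 1`,
there is `g ∈ SU(4, q)` of order `r` intersecting the center trivially; moreover `g` may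
be chosen with characteristic polynomial `(X - 1)(X - θ)(X - θ^{-q})(X - θ^{q²})` over
`F_{q⁶}`, where `θ` has multiplicative order `r`. -/
theorem su4_element_order_r6
    (p m q : ℕ) [Fact p.Prime] (hq : q = p ^ m) (hodd : Odd q)
    (F : Type) [Field F] [Fintype F] [CharP F p] (hF : Fintype.card F = (p ^ m) ^ 2)
    (E : Type) [Field E] [Fintype E] (hE : Fintype.card E = q ^ 6)
    (f : F →+* E)
    (r : ℕ) (hr : r.Prime) (hrdvd : r ∣ q ^ 2 - q + 1) (hrnd : ¬ r ∣ q + 1) :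
    ∃ g : (SU4 p m F hF), orderOf g = r ∧
      Subgroup.zpowers g ⊓ Subgroup.center (SU4 p m F hF) = ⊥ ∧
      ∃ θ : Eˣ, orderOf θ = r ∧
        Matrix.charpoly
            (((g : SpecialLinearGroup (Fin 4) F) : Matrix (Fin 4) (Fin 4) F).map f) =
          (X - 1) * (X - C ((θ : E))) * (X - C ((θ ^ (-(q : ℤ)) : Eˣ) : E)) *
            (X - C ((θ ^ ((q : ℤ) ^ 2) : Eˣ) : E)) := by
  have hF' : Fintype.card F = q ^ 2 := hq ▸ hF
  let _ : Algebra F E := f.toAlgebra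
  have : CharP E p := charP_of_injective_ringHom f.injective p
  have : Fact r.Prime := ⟨hr⟩
  have h2 : (2 : F) ≠ 0 := two_ne_zero_of_odd_card (hF' ▸ hodd.pow)
  have hcube := dvd_cube_add_one hrdvd
  have hsq := not_dvd_sq_sub_one hr hrdvd hrnd
  have hcard : r ∣ Nat.card Eˣ := by
    classical
    rw [Nat.card_eq_fintype_card, Fintype.card_units, hE]
    refine hcube.trans ⟨q ^ 3 - 1, ?_⟩
    rw [show q ^ 6 - 1 = (q ^ 3) ^ 2 - 1 ^ 2 by ring_nf, Nat.sq_sub_sq]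
  obtain ⟨θ, hθ⟩ := exists_prime_orderOf_dvd_card' r hcard
  have hpow : ∀ n : ℕ, r ∣ n → θ ^ n = 1 := fun n hn ↦ orderOf_dvd_iff_pow_eq_one.1 (hθ ▸ hn)
  have hθ1 : θ ≠ 1 := fun h ↦ hr.one_lt.ne' (by rw [← hθ, h, orderOf_one])
  have hθq2 : θ ^ q ^ 2 ≠ θ := fun h ↦ hsq <| by
    rw [← hθ, orderOf_dvd_iff_zpow_eq_one, _root_.zpow_sub, zpow_one]
    exact mul_inv_eq_one.2 (by exact_mod_cast h)
  have hθ4 : θ ^ q ^ 4 * θ ^ q = 1 := by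
    rw [← pow_add]
    refine hpow _ (hcube.trans ⟨q, ?_⟩)
    ring
  have hθq4 : θ ^ q ^ 4 ≠ θ := fun h ↦ hrnd <| by
    rw [← hθ, orderOf_dvd_iff_pow_eq_one, pow_succ']
    rwa [h] at hθ4
  have hinj : Function.Injective fun x : Eˣ ↦ x ^ q ^ 2 := fun x y hxy ↦ by
    have hxE : (x : E) ^ q ^ 2 = (y : E) ^ q ^ 2 := by exact_mod_cast congrArg Units.val hxy
    rw [← hF'] at hxE
    exact Units.ext ((FiniteField.frobeniusAlgHom F E).injective hxE)
  have hsplit : ∀ x : Eˣ, x ^ q ^ 4 = (x ^ q ^ 2) ^ q ^ 2 := fun x ↦ by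
    rw [← pow_mul, ← pow_add]
  have hθq21 : θ ^ q ^ 2 ≠ 1 := fun h ↦ hθ1 (hinj (by simpa using h))
  have hθq41 : θ ^ q ^ 4 ≠ 1 := fun h ↦ hθq21 (hinj (by simpa [hsplit] using h))
  have hθq42 : θ ^ q ^ 4 ≠ θ ^ q ^ 2 := fun h ↦ hθq2 (hinj (by simpa [hsplit] using h))
  have hnodup : ({1, (θ : E), (θ : E) ^ q ^ 4, (θ : E) ^ q ^ 2} : Multiset E).Nodup := by
    rw [← Units.val_one]
    simp only [← Units.val_pow_eq_pow_val, Multiset.insert_eq_cons,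
      Multiset.nodup_cons, Multiset.mem_cons, Multiset.mem_singleton, Units.val_inj,
      Multiset.nodup_singleton, not_or, and_true]
    exact ⟨⟨hθ1.symm, hθq41.symm, hθq21.symm⟩, ⟨hθq4.symm, hθq2.symm⟩, hθq42⟩
  obtain ⟨b, hb⟩ := exists_basis_leftMulMatrix_unitary (p := p) (m := m) hq hodd hF' hE (θ : E)
    (congrArg Units.val ((pow_succ θ _).symm.trans (hpow _ hcube)))
  have hchar := charpoly_leftMulMatrix_one_prod hF' b (θ : E) hnodup
  set A := Algebra.leftMulMatrix b (1, (θ : E)) with hA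
  have hneg : θ ^ (-(q : ℤ)) = θ ^ q ^ 4 := by
    rw [_root_.zpow_neg, zpow_natCast, eq_comm]
    exact eq_inv_of_mul_eq_one_left hθ4
  have hdet : A.det = 1 := by
    apply (algebraMap F E).injective
    have hprod : θ * θ ^ q ^ 4 * θ ^ q ^ 2 = 1 := by
      have hle : q ≤ q ^ 2 := Nat.le_self_pow two_ne_zero q
      rw [← hneg, ← hpow _ hrdvd, ← zpow_natCast, ← zpow_natCast, ← _root_.zpow_one_add,
        ← _root_.zpow_add]
      congr 1
      push_cast [hle]
      ring
    have hprodE : (θ : E) * (θ : E) ^ q ^ 4 * (θ : E) ^ q ^ 2 = 1 :=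
      congrArg Units.val hprod
    rw [RingHom.map_det, RingHom.mapMatrix_apply, det_eq_sign_charpoly_coeff, hchar, map_one,
      coeff_zero_eq_eval_zero]
    simp only [eval_mul, eval_sub, eval_X, eval_one, eval_C, Fintype.card_fin]
    linear_combination hprodE
  let g : SU4 p m F hF := ⟨⟨A, hdet⟩, hb⟩
  have hg : orderOf g = r := by
    refine orderOf_eq_prime (Subtype.ext (Subtype.ext ?_)) fun h ↦ hθ1 ?_
    · change A ^ r = 1
      rw [hA, ← map_pow, Prod.pow_mk, one_pow, ← Units.val_pow_eq_pow_val, hpow r dvd_rfl]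
      exact map_one _
    · have hA1 : A = 1 := congrArg (fun a : SU4 p m F hF ↦ (a : SpecialLinearGroup (Fin 4) F).1) h
      rw [← map_one (Algebra.leftMulMatrix b)] at hA1
      exact Units.ext (congrArg Prod.snd (Algebra.leftMulMatrix_injective b hA1))
  refine ⟨g, hg, zpowers_inf_eq_bot_of_prime_orderOf hr hg fun hcen ↦ hθq2 ?_, θ, hθ, ?_⟩
  · obtain ⟨a, ha⟩ := SU4.exists_eq_of_mem_center h2 hcen (algebraMap F E) (x := θ) (by
      change (A.map _).charpoly.IsRoot _
      rw [hchar]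
      simp)
    ext
    rw [Units.val_pow_eq_pow_val, ← ha, ← map_pow, ← hF', FiniteField.pow_card]
  · rw [hneg, show (q : ℤ) ^ 2 = ((q ^ 2 : ℕ) : ℤ) by push_cast; rfl, zpow_natCast]
    exact hchar
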